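/- Assume A ≠ ∅, core coverage (either P_A = 0 and Ŝ_O ∩ Cn(S_O) ≠ ∅, or P_A > 0 and R_Cn(a) ≠ ∅ for every a ∈ A), and pairwise realisability: for every nonempty W ⊆ A, if R_Cn(a) ∩ R_Cn(a') ≠ ∅ for all distinct a, a' ∈ W, then ⋂_{a∈W} R_Cn(a) ≠ ∅. Define the core incompatibility graph G_inc on vertex set A with an edge between a ≠ a' exactly when R_Cn(a) ∩ R_Cn(a') = ∅, and define the graph entropy H_{G_inc}(π_A) as the infimum of I(π_A, K) over all test channels K from A to the finite set of nonempty subsets of A such that for every a ∈ A with π_A(a) > 0 and every subset w with K(w|a) > 0 one has a ∈ w and w is an independent set of G_inc. Then R_sem(0) = P_A·H_{G_inc}(π_A), with the convention that the right-hand side is 0 when P_A = 0. -/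

import Mathlib

open scoped BigOperators Classical

noncomputable section

variable {𝕊 : Type*} [Fintype 𝕊]

/-- One step of the deletion procedure. -/
def atomStep (Cn : Set 𝕊 → Set 𝕊) (A : Set 𝕊) (s : 𝕊) : Set 𝕊 :=
  if s ∈ Cn (A \ {s}) then A \ {s} else A

/-- The deletion procedure; `Atom(S_O) = atomCore Cn S_O L`. -/
def atomCore (Cn : Set 𝕊 → Set 𝕊) (S : Set 𝕊) (L : List 𝕊) : Set 𝕊 :=
  L.foldl (atomStep Cn) S

/-- Shannon entropy of a probability vector on a finite type
(natural logarithm; `Real.log 0 = 0` handles the `0·log 0 := 0` convention). -/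
def entropy {X : Type*} [Fintype X] (p : X → ℝ) : ℝ :=
  -∑ x, p x * Real.log (p x)

/-- Mutual information `I(p,W) := H(p) + H(q̂) − H(q)` of a source `p` and a
channel `W`, where `q(x,y) = p(x)·W(y|x)` and `q̂` is the output marginal. -/
def mutualInfo {X Y : Type*} [Fintype X] [Fintype Y]
    (p : X → ℝ) (W : X → Y → ℝ) : ℝ :=
  entropy p + entropy (fun y => ∑ x, p x * W x y)
    - entropy (fun z : X × Y => p z.1 * W z.1 z.2)

/-- A test channel into the alphabet `Yset`: rows are probability vectors
supported inside `Yset`. -/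
def IsChannel {X Y : Type*} [Fintype Y] (W : X → Y → ℝ) (Yset : Set Y) : Prop :=
  (∀ x y, 0 ≤ W x y) ∧ (∀ x, ∑ y, W x y = 1) ∧ (∀ x y, W x y ≠ 0 → y ∈ Yset)

/-- A probability vector supported on `S`. -/
def IsProbVector {X : Type*} [Fintype X] (p : X → ℝ) (S : Set X) : Prop :=
  (∀ x, 0 ≤ p x) ∧ (∑ x, p x = 1) ∧ (∀ x, p x ≠ 0 → x ∈ S)

/-- The probability mass `p(A)` of a set `A`. -/
def massOn {X : Type*} [Fintype X] (p : X → ℝ) (A : Set X) : ℝ :=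
  ∑ x, if x ∈ A then p x else 0

/-- The conditional distribution of `p` given `A`. -/
def condOn {X : Type*} [Fintype X] (p : X → ℝ) (A : Set X) : X → ℝ :=
  fun x => if x ∈ A then p x / massOn p A else 0

/-- Zero-distortion reconstruction set
`R_Cn(s) := {shat ∈ Shat_O : Cn((S_O \ {s}) ∪ {shat}) = Cn(S_O)}`. -/
def RCn (Cn : Set 𝕊 → Set 𝕊) (S_O Shat_O : Set 𝕊) (s : 𝕊) : Set 𝕊 :=
  {shat ∈ Shat_O | Cn ((S_O \ {s}) ∪ {shat}) = Cn S_O}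

/-- The channel `W` achieves zero closure distortion for the source `p`. -/
def ZeroClosureDist (Cn : Set 𝕊 → Set 𝕊) (S_O : Set 𝕊)
    (p : 𝕊 → ℝ) (W : 𝕊 → 𝕊 → ℝ) : Prop :=
  ∀ s : 𝕊, 0 < p s → ∀ shat : 𝕊, 0 < W s shat →
    Cn ((S_O \ {s}) ∪ {shat}) = Cn S_O

/-- `R_sem(0)`: the infimum of `I(p,W)` over all zero-closure-distortion test
channels from `S_O` to `Shat_O` (infimum of the empty set is `⊤ = +∞`). -/
def RsemZero (Cn : Set 𝕊 → Set 𝕊) (S_O Shat_O : Set 𝕊) (p : 𝕊 → ℝ) : EReal :=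
  sInf {r : EReal | ∃ W : 𝕊 → 𝕊 → ℝ, IsChannel W Shat_O ∧
    ZeroClosureDist Cn S_O p W ∧ r = ((mutualInfo p W : ℝ) : EReal)}

/-- Independent sets of the core incompatibility graph `G_inc` on vertex set
`A`: subsets `w ⊆ A` with no two distinct members having disjoint
zero-distortion reconstruction sets (i.e. no edge inside `w`). -/
def IsIndepSet (Cn : Set 𝕊 → Set 𝕊) (S_O Shat_O A : Set 𝕊)
    (w : Finset 𝕊) : Prop :=
  ↑w ⊆ A ∧ ∀ a ∈ w, ∀ a' ∈ w, a ≠ a' →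
    (RCn Cn S_O Shat_O a ∩ RCn Cn S_O Shat_O a').Nonempty

/-- Körner-style graph entropy `H_G(π)`: the infimum of `I(π, K)` over test
channels `K` from the core to nonempty subsets of `A` such that, on the
support of `π`, every output `w` contains the input and is an independent set
of the incompatibility graph. -/
def graphEntropy (Cn : Set 𝕊 → Set 𝕊) (S_O Shat_O A : Set 𝕊)
    (π : 𝕊 → ℝ) : EReal :=
  sInf {r : EReal | ∃ K : 𝕊 → Finset 𝕊 → ℝ,
    IsChannel K {w : Finset 𝕊 | w.Nonempty ∧ ↑w ⊆ A} ∧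
    (∀ a : 𝕊, 0 < π a → ∀ w : Finset 𝕊, 0 < K a w →
      a ∈ w ∧ IsIndepSet Cn S_O Shat_O A w) ∧
    r = ((mutualInfo π K : ℝ) : EReal)}

/-- Relative entropy `∑ a log (a / b)` of two nonnegative vectors on a finite type. -/
def relEnt {Y : Type*} [Fintype Y] (a b : Y → ℝ) : ℝ :=
  ∑ y, a y * (Real.log (a y) - Real.log (b y))

/-- Output marginal of the source `p` under the channel `W`. -/
def outMarginal {X Y : Type*} [Fintype X] (p : X → ℝ) (W : X → Y → ℝ) : Y → ℝ :=
  fun y => ∑ x, p x * W x y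

/-- Push-forward of a vector along a map. -/
def pushVec {Y Z : Type*} [Fintype Y] (f : Y → Z) (a : Y → ℝ) : Z → ℝ :=
  fun z => ∑ y with f y = z, a y

/-- The log-sum inequality. -/
lemma log_sum_inequality {ι : Type*} (s : Finset ι) (a b : ι → ℝ)
    (ha : ∀ i ∈ s, 0 ≤ a i) (hb : ∀ i ∈ s, 0 ≤ b i) (hab : ∀ i ∈ s, 0 < a i → 0 < b i) :
    (∑ i ∈ s, a i) * (Real.log (∑ i ∈ s, a i) - Real.log (∑ i ∈ s, b i)) ≤
      ∑ i ∈ s, a i * (Real.log (a i) - Real.log (b i)) := by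
  rcases (Finset.sum_nonneg ha).eq_or_lt with hA | hA
  · have h0 := (Finset.sum_eq_zero_iff_of_nonneg ha).1 hA.symm
    rw [← hA, zero_mul, Finset.sum_eq_zero]
    intro i hi
    rw [h0 i hi, zero_mul]
  obtain ⟨j, hj, hj0⟩ := Finset.exists_ne_zero_of_sum_ne_zero hA.ne'
  have hB : 0 < ∑ i ∈ s, b i :=
    (hab j hj ((ha j hj).lt_of_ne' hj0)).trans_le (Finset.single_le_sum hb hj)
  set A := ∑ i ∈ s, a i with hAdef
  set B := ∑ i ∈ s, b i with hBdef
  have key : ∀ i ∈ s, a i * (Real.log A - Real.log B) + a i - b i * (A / B) ≤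
      a i * (Real.log (a i) - Real.log (b i)) := by
    intro i hi
    rcases (ha i hi).eq_or_lt with h | h
    · rw [← h]
      have := mul_nonneg (hb i hi) (div_pos hA hB).le
      linarith
    · have hbi := hab i hi h
      have hlog := Real.log_le_sub_one_of_pos (mul_pos (div_pos hbi h) (div_pos hA hB))
      rw [Real.log_mul (div_pos hbi h).ne' (div_pos hA hB).ne', Real.log_div hbi.ne' h.ne',
        Real.log_div hA.ne' hB.ne'] at hlog
      have hmul := mul_le_mul_of_nonneg_left hlog h.le
      have heq : a i * (b i / a i * (A / B) - 1) = b i * (A / B) - a i := by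
        field_simp
      rw [heq] at hmul
      linarith
  have hsum := Finset.sum_le_sum key
  rw [Finset.sum_sub_distrib, Finset.sum_add_distrib, ← Finset.sum_mul, ← Finset.sum_mul,
    ← hAdef, ← hBdef, mul_div_cancel₀ A hB.ne'] at hsum
  linarith

lemma relEnt_self {Y : Type*} [Fintype Y] (a : Y → ℝ) : relEnt a a = 0 := by
  simp [relEnt]

lemma relEnt_nonneg {Y : Type*} [Fintype Y] {a b : Y → ℝ} (ha : ∀ y, 0 ≤ a y)
    (hb : ∀ y, 0 ≤ b y) (hab : ∀ y, 0 < a y → 0 < b y) (ha1 : ∑ y, a y = 1)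
    (hb1 : ∑ y, b y = 1) : 0 ≤ relEnt a b := by
  have h := log_sum_inequality Finset.univ a b (fun y _ => ha y) (fun y _ => hb y)
    (fun y _ => hab y)
  simpa [ha1, hb1, relEnt] using h

lemma relEnt_pushVec_le {Y Z : Type*} [Fintype Y] [Fintype Z] (f : Y → Z) {a b : Y → ℝ}
    (ha : ∀ y, 0 ≤ a y) (hb : ∀ y, 0 ≤ b y) (hab : ∀ y, 0 < a y → 0 < b y) :
    relEnt (pushVec f a) (pushVec f b) ≤ relEnt a b := by
  unfold relEnt pushVec
  rw [← Finset.sum_fiberwise Finset.univ f (fun y => a y * (Real.log (a y) - Real.log (b y)))]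
  exact Finset.sum_le_sum fun z _ => log_sum_inequality _ a b (fun y _ => ha y) (fun y _ => hb y)
    (fun y _ => hab y)

lemma outMarginal_nonneg {X Y : Type*} [Fintype X] {p : X → ℝ} {W : X → Y → ℝ}
    (hp : ∀ x, 0 ≤ p x) (hW : ∀ x y, 0 ≤ W x y) (y : Y) : 0 ≤ outMarginal p W y :=
  Finset.sum_nonneg fun x _ => mul_nonneg (hp x) (hW x y)

lemma outMarginal_pos {X Y : Type*} [Fintype X] {p : X → ℝ} {W : X → Y → ℝ}
    (hp : ∀ x, 0 ≤ p x) (hW : ∀ x y, 0 ≤ W x y) {x : X} {y : Y} (hx : 0 < p x)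
    (hxy : 0 < W x y) : 0 < outMarginal p W y :=
  (mul_pos hx hxy).trans_le
    (Finset.single_le_sum (f := fun x => p x * W x y)
      (fun x _ => mul_nonneg (hp x) (hW x y)) (Finset.mem_univ x))

lemma sum_outMarginal {X Y : Type*} [Fintype X] [Fintype Y] {p : X → ℝ} {W : X → Y → ℝ}
    (hp : ∑ x, p x = 1) (hW : ∀ x, ∑ y, W x y = 1) : ∑ y, outMarginal p W y = 1 := by
  unfold outMarginal
  rw [Finset.sum_comm]
  simp [← Finset.mul_sum, hW, hp]

lemma sum_mul_outMarginal {X Y : Type*} [Fintype X] [Fintype Y] (p : X → ℝ) (W : X → Y → ℝ)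
    (g : Y → ℝ) : ∑ y, outMarginal p W y * g y = ∑ x, p x * ∑ y, W x y * g y := by
  unfold outMarginal
  simp_rw [Finset.sum_mul, Finset.mul_sum]
  rw [Finset.sum_comm]
  simp_rw [mul_assoc]

lemma outMarginal_pushVec {X Y Z : Type*} [Fintype X] [Fintype Y] (p : X → ℝ)
    (W : X → Y → ℝ) (f : Y → Z) :
    outMarginal p (fun x => pushVec f (W x)) = pushVec f (outMarginal p W) := by
  funext z
  unfold outMarginal pushVec
  simp_rw [Finset.mul_sum]
  rw [Finset.sum_comm]

/-- Mutual information is the average divergence of the rows from the output marginal. -/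
lemma mutualInfo_eq_sum_relEnt {X Y : Type*} [Fintype X] [Fintype Y] (p : X → ℝ)
    (W : X → Y → ℝ) (hW : ∀ x, ∑ y, W x y = 1) :
    mutualInfo p W = ∑ x, p x * relEnt (W x) (outMarginal p W) := by
  have hjoint : ∑ z : X × Y, p z.1 * W z.1 z.2 * Real.log (p z.1 * W z.1 z.2) =
      ∑ x, p x * Real.log (p x) + ∑ x, p x * ∑ y, W x y * Real.log (W x y) := by
    rw [Fintype.sum_prod_type, ← Finset.sum_add_distrib]
    refine Finset.sum_congr rfl fun x _ => ?_
    have hrow : ∀ y, p x * W x y * Real.log (p x * W x y) =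
        p x * Real.log (p x) * W x y + p x * (W x y * Real.log (W x y)) := by
      intro y
      by_cases h1 : p x = 0
      · simp [h1]
      by_cases h2 : W x y = 0
      · simp [h2]
      rw [Real.log_mul h1 h2]
      ring
    simp_rw [hrow]
    rw [Finset.sum_add_distrib, ← Finset.mul_sum, ← Finset.mul_sum, hW x, mul_one]
  have hout := sum_mul_outMarginal p W (fun y => Real.log (outMarginal p W y))
  simp only [relEnt, mul_sub, Finset.sum_sub_distrib]
  unfold mutualInfo entropy
  rw [hjoint]
  change _ + -(∑ y, outMarginal p W y * Real.log (outMarginal p W y)) - _ = _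
  rw [hout]
  ring

/-- The output marginal minimises the average divergence of the rows of a channel. -/
lemma mutualInfo_le_sum_relEnt {X Y : Type*} [Fintype X] [Fintype Y] {p : X → ℝ}
    {W : X → Y → ℝ} {r : Y → ℝ} (hp : ∀ x, 0 ≤ p x) (hp1 : ∑ x, p x = 1)
    (hW : ∀ x y, 0 ≤ W x y) (hW1 : ∀ x, ∑ y, W x y = 1) (hr : ∀ y, 0 ≤ r y)
    (hr1 : ∑ y, r y = 1) (hpr : ∀ y, 0 < outMarginal p W y → 0 < r y) :
    mutualInfo p W ≤ ∑ x, p x * relEnt (W x) r := by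
  have hnn := relEnt_nonneg (outMarginal_nonneg hp hW) hr hpr (sum_outMarginal hp1 hW1) hr1
  have h1 := sum_mul_outMarginal p W (fun y => Real.log (outMarginal p W y))
  have h2 := sum_mul_outMarginal p W (fun y => Real.log (r y))
  rw [mutualInfo_eq_sum_relEnt p W hW1]
  simp only [relEnt, mul_sub, Finset.sum_sub_distrib] at hnn ⊢
  linarith

lemma mutualInfo_nonneg {X Y : Type*} [Fintype X] [Fintype Y] {p : X → ℝ} {W : X → Y → ℝ}
    (hp : ∀ x, 0 ≤ p x) (hp1 : ∑ x, p x = 1) (hW : ∀ x y, 0 ≤ W x y)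
    (hW1 : ∀ x, ∑ y, W x y = 1) : 0 ≤ mutualInfo p W := by
  rw [mutualInfo_eq_sum_relEnt p W hW1]
  refine Finset.sum_nonneg fun x _ => ?_
  rcases (hp x).eq_or_lt with h | h
  · simp [← h]
  · exact mul_nonneg h.le (relEnt_nonneg (hW x) (outMarginal_nonneg hp hW)
      (fun y hy => outMarginal_pos hp hW h hy) (hW1 x) (sum_outMarginal hp1 hW1))

lemma mutualInfo_const {X Y : Type*} [Fintype X] [Fintype Y] {p : X → ℝ} (hp1 : ∑ x, p x = 1)
    {r : Y → ℝ} (hr1 : ∑ y, r y = 1) : mutualInfo p (fun _ => r) = 0 := by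
  have hout : outMarginal p (fun _ => r) = r := by
    funext y
    simp [outMarginal, ← Finset.sum_mul, hp1]
  rw [mutualInfo_eq_sum_relEnt _ _ fun _ => hr1, hout, relEnt_self]
  simp

lemma IsChannel.pushVec {X Y Z : Type*} [Fintype Y] [Fintype Z] {W : X → Y → ℝ} {S : Set Y}
    {T : Set Z} (hW : IsChannel W S) (f : Y → Z) (hf : ∀ y, f y ∈ T) :
    IsChannel (fun x => pushVec f (W x)) T := by
  refine ⟨fun x z => Finset.sum_nonneg fun y _ => hW.1 x y, fun x => ?_, fun x z hz => ?_⟩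
  · unfold _root_.pushVec
    rw [Finset.sum_fiberwise Finset.univ f (W x), hW.2.1 x]
  · obtain ⟨y, hy, -⟩ := Finset.exists_ne_zero_of_sum_ne_zero hz
    rw [← (Finset.mem_filter.1 hy).2]
    exact hf y

lemma exists_pos_of_pushVec_pos {Y Z : Type*} [Fintype Y] {f : Y → Z} {a : Y → ℝ} {z : Z}
    (h : 0 < pushVec f a z) : ∃ y, f y = z ∧ 0 < a y := by
  obtain ⟨y, hy, hpos⟩ := Finset.exists_lt_of_sum_lt (f := fun _ => (0 : ℝ)) (g := a)
    (s := Finset.univ.filter fun y => f y = z) (by simpa [pushVec] using h)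
  exact ⟨y, (Finset.mem_filter.1 hy).2, hpos⟩

/-- Data processing inequality for a deterministic map of the output. -/
lemma mutualInfo_pushVec_le {X Y Z : Type*} [Fintype X] [Fintype Y] [Fintype Z] {p : X → ℝ}
    {W : X → Y → ℝ} {S : Set Y} (hp : ∀ x, 0 ≤ p x) (hW : IsChannel W S) (f : Y → Z) :
    mutualInfo p (fun x => pushVec f (W x)) ≤ mutualInfo p W := by
  have hpush := hW.pushVec f (T := Set.univ) fun _ => trivial
  rw [mutualInfo_eq_sum_relEnt p W hW.2.1, mutualInfo_eq_sum_relEnt p _ hpush.2.1,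
    outMarginal_pushVec]
  refine Finset.sum_le_sum fun x _ => ?_
  rcases (hp x).eq_or_lt with h | h
  · simp [← h]
  · exact mul_le_mul_of_nonneg_left (relEnt_pushVec_le f (hW.1 x)
      (outMarginal_nonneg hp hW.1) fun y hy => outMarginal_pos hp hW.1 h hy) h.le

section Conditioning

variable {X Y : Type*} [Fintype X] {p : X → ℝ} {A : Set X}

lemma condOn_nonneg (hp : ∀ x, 0 ≤ p x) (x : X) : 0 ≤ condOn p A x := by
  unfold condOn massOn
  split_ifs
  · exact div_nonneg (hp x) (Finset.sum_nonneg fun y _ => by split_ifs <;> simp [hp y])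
  · exact le_rfl

lemma massOn_mul_condOn (hA : 0 < massOn p A) (x : X) :
    massOn p A * condOn p A x = if x ∈ A then p x else 0 := by
  unfold condOn
  split_ifs
  · exact mul_div_cancel₀ _ hA.ne'
  · exact mul_zero _

lemma sum_condOn (hA : 0 < massOn p A) : ∑ x, condOn p A x = 1 := by
  refine mul_left_cancel₀ hA.ne' ?_
  rw [Finset.mul_sum, mul_one]
  exact Finset.sum_congr rfl fun x _ => massOn_mul_condOn hA x

lemma condOn_pos_iff (hA : 0 < massOn p A) (x : X) :
    0 < condOn p A x ↔ x ∈ A ∧ 0 < p x := by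
  unfold condOn
  split_ifs with h
  · simp [h, div_pos_iff_of_pos_right hA]
  · simp [h]

lemma massOn_mul_sum_condOn (hA : 0 < massOn p A) (g : X → ℝ) :
    massOn p A * ∑ x, condOn p A x * g x = ∑ x, if x ∈ A then p x * g x else 0 := by
  rw [Finset.mul_sum]
  refine Finset.sum_congr rfl fun x _ => ?_
  rw [← mul_assoc, massOn_mul_condOn hA, ite_mul, zero_mul]

/-- Restricting the source to a set can only lose information. -/
lemma massOn_mul_mutualInfo_condOn_le [Fintype Y] {W : X → Y → ℝ} (hp : ∀ x, 0 ≤ p x)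
    (hp1 : ∑ x, p x = 1) (hW : ∀ x y, 0 ≤ W x y) (hW1 : ∀ x, ∑ y, W x y = 1)
    (hA : 0 < massOn p A) :
    massOn p A * mutualInfo (condOn p A) W ≤ mutualInfo p W := by
  have hle : mutualInfo (condOn p A) W ≤
      ∑ x, condOn p A x * relEnt (W x) (outMarginal p W) := by
    refine mutualInfo_le_sum_relEnt (condOn_nonneg hp) (sum_condOn hA) hW hW1
      (outMarginal_nonneg hp hW) (sum_outMarginal hp1 hW1) fun y hy => ?_
    obtain ⟨x, -, hx⟩ := Finset.exists_lt_of_sum_lt (f := fun _ : X => (0 : ℝ))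
      (g := fun x => condOn p A x * W x y) (s := Finset.univ) (by simpa [outMarginal] using hy)
    have hc : 0 < condOn p A x := pos_of_mul_pos_left hx (hW x y)
    exact outMarginal_pos hp hW ((condOn_pos_iff hA x).1 hc).2
      (pos_of_mul_pos_right hx hc.le)
  refine (mul_le_mul_of_nonneg_left hle hA.le).trans ?_
  rw [massOn_mul_sum_condOn hA, mutualInfo_eq_sum_relEnt p W hW1]
  refine Finset.sum_le_sum fun x _ => ?_
  split_ifs
  · exact le_rfl
  · rcases (hp x).eq_or_lt with h | h
    · simp [← h]
    · exact mul_nonneg h.le (relEnt_nonneg (hW x) (outMarginal_nonneg hp hW)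
        (fun y hy => outMarginal_pos hp hW h hy) (hW1 x) (sum_outMarginal hp1 hW1))

/-- Extend a channel outside `A` by the constant row equal to its output marginal on `A`. -/
def extendChannel (p : X → ℝ) (A : Set X) (W : X → Y → ℝ) : X → Y → ℝ :=
  fun x => if x ∈ A then W x else outMarginal (condOn p A) W

lemma outMarginal_extendChannel {W : X → Y → ℝ} (hp1 : ∑ x, p x = 1) (hA : 0 < massOn p A) :
    outMarginal p (extendChannel p A W) = outMarginal (condOn p A) W := by
  funext y
  have hsplit : ∀ x, p x * extendChannel p A W x y =
      (if x ∈ A then p x * W x y else 0) +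
        (p x - if x ∈ A then p x else 0) * outMarginal (condOn p A) W y := by
    intro x
    unfold extendChannel
    split_ifs <;> simp
  have hmass : ∑ x, (if x ∈ A then p x else 0) = massOn p A := rfl
  have hcond := massOn_mul_sum_condOn hA fun x => W x y
  change massOn p A * outMarginal (condOn p A) W y = _ at hcond
  change ∑ x, p x * extendChannel p A W x y = _
  simp_rw [hsplit]
  rw [Finset.sum_add_distrib, ← Finset.sum_mul, Finset.sum_sub_distrib, hp1, hmass, ← hcond]
  ring

lemma mutualInfo_extendChannel [Fintype Y] {W : X → Y → ℝ} (hp1 : ∑ x, p x = 1)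
    (hW1 : ∀ x, ∑ y, W x y = 1) (hA : 0 < massOn p A) :
    mutualInfo p (extendChannel p A W) = massOn p A * mutualInfo (condOn p A) W := by
  have hrow : ∀ x, ∑ y, extendChannel p A W x y = 1 := by
    intro x
    unfold extendChannel
    split_ifs
    · exact hW1 x
    · exact sum_outMarginal (sum_condOn hA) hW1
  rw [mutualInfo_eq_sum_relEnt _ _ hrow, mutualInfo_eq_sum_relEnt _ _ hW1,
    outMarginal_extendChannel hp1 hA, massOn_mul_sum_condOn hA]
  refine Finset.sum_congr rfl fun x _ => ?_
  unfold extendChannel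
  split_ifs
  · rfl
  · rw [relEnt_self, mul_zero]

lemma IsChannel.extendChannel [Fintype Y] {W : X → Y → ℝ} {S : Set Y} (hW : IsChannel W S)
    (hp : ∀ x, 0 ≤ p x) (hA : 0 < massOn p A) : IsChannel (extendChannel p A W) S := by
  refine ⟨fun x y => ?_, fun x => ?_, fun x y hxy => ?_⟩ <;> unfold _root_.extendChannel at *
  · split_ifs
    · exact hW.1 x y
    · exact outMarginal_nonneg (condOn_nonneg hp) hW.1 y
  · split_ifs
    · exact hW.2.1 x
    · exact sum_outMarginal (sum_condOn hA) hW.2.1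
  · split_ifs at hxy
    · exact hW.2.2 x y hxy
    · obtain ⟨x', -, hx'⟩ := Finset.exists_ne_zero_of_sum_ne_zero hxy
      exact hW.2.2 x' y (right_ne_zero_of_mul hx')

end Conditioning

section Closure

variable {T : Type*} {Cn : Set T → Set T}

lemma atomCore_subset (S : Set T) (L : List T) : atomCore Cn S L ⊆ S := by
  induction L generalizing S with
  | nil => exact subset_rfl
  | cons s L ih =>
    refine (ih (atomStep Cn S s)).trans ?_
    unfold atomStep
    split_ifs
    · exact Set.sdiff_subset
    · exact subset_rfl

lemma Cn_eq_of_subset_of_subset (hmono : ∀ Γ Γ' : Set T, Γ ⊆ Γ' → Cn Γ ⊆ Cn Γ')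
    (hidem : ∀ Γ : Set T, Cn (Cn Γ) = Cn Γ) {Γ Γ' : Set T} (h : Γ ⊆ Γ') (h' : Γ' ⊆ Cn Γ) :
    Cn Γ' = Cn Γ :=
  ((hmono _ _ h').trans (hidem Γ).subset).antisymm (hmono _ _ h)

lemma Cn_atomCore (hrefl : ∀ Γ : Set T, Γ ⊆ Cn Γ)
    (hmono : ∀ Γ Γ' : Set T, Γ ⊆ Γ' → Cn Γ ⊆ Cn Γ')
    (hidem : ∀ Γ : Set T, Cn (Cn Γ) = Cn Γ) (S : Set T) (L : List T) :
    Cn (atomCore Cn S L) = Cn S := by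
  induction L generalizing S with
  | nil => rfl
  | cons s L ih =>
    refine (ih (atomStep Cn S s)).trans ?_
    unfold atomStep
    split_ifs with h
    · refine (Cn_eq_of_subset_of_subset hmono hidem Set.sdiff_subset fun t ht => ?_).symm
      by_cases hts : t = s
      · exact hts ▸ h
      · exact hrefl _ ⟨ht, hts⟩
    · rfl

/-- Replacing a redundant statement by any consequence preserves the closure. -/
lemma Cn_replace_of_redundant (hrefl : ∀ Γ : Set T, Γ ⊆ Cn Γ)
    (hmono : ∀ Γ Γ' : Set T, Γ ⊆ Γ' → Cn Γ ⊆ Cn Γ')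
    (hidem : ∀ Γ : Set T, Cn (Cn Γ) = Cn Γ) {S A : Set T} (hAS : A ⊆ S) (hA : Cn A = Cn S)
    {s t : T} (hs : s ∉ A) (ht : t ∈ Cn S) : Cn ((S \ {s}) ∪ {t}) = Cn S := by
  rw [← hA]
  refine Cn_eq_of_subset_of_subset hmono hidem
    (fun a ha => Or.inl ⟨hAS ha, fun h => hs (h ▸ ha)⟩) ?_
  rw [hA]
  rintro x (hx | rfl)
  · exact hrefl _ hx.1
  · exact ht

lemma RCn_subset_Cn (hrefl : ∀ Γ : Set T, Γ ⊆ Cn Γ) {S_O Shat_O : Set T} {s t : T}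
    (ht : t ∈ RCn Cn S_O Shat_O s) : t ∈ Cn S_O := by
  rw [← ht.2]
  exact hrefl _ (Or.inr rfl)

end Closure


/-- Graph-entropy law under pairwise realisability: under
core coverage and pairwise realisability, `R_sem(0) = P_A · H_{G_inc}(π_A)`,
with the convention that the right-hand side is `0` when `P_A = 0`. -/
theorem confusable_graph_entropy
    (Cn : Set 𝕊 → Set 𝕊)
    (hrefl : ∀ Γ : Set 𝕊, Γ ⊆ Cn Γ)
    (hmono : ∀ Γ Γ' : Set 𝕊, Γ ⊆ Γ' → Cn Γ ⊆ Cn Γ')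
    (hidem : ∀ Γ : Set 𝕊, Cn (Cn Γ) = Cn Γ)
    (S_O Shat_O : Set 𝕊) (L : List 𝕊)
    (hnodup : L.Nodup)
    (henum : ∀ s : 𝕊, s ∈ L ↔ s ∈ S_O)
    (p : 𝕊 → ℝ) (hp : IsProbVector p S_O)
    (hAne : (atomCore Cn S_O L).Nonempty)
    (hcover :
      (massOn p (atomCore Cn S_O L) = 0 ∧ (Shat_O ∩ Cn S_O).Nonempty) ∨
      (0 < massOn p (atomCore Cn S_O L) ∧
        ∀ a ∈ atomCore Cn S_O L, (RCn Cn S_O Shat_O a).Nonempty))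
    (hpairwise : ∀ w : Finset 𝕊, ↑w ⊆ atomCore Cn S_O L → w.Nonempty →
      (∀ a ∈ w, ∀ a' ∈ w, a ≠ a' →
        (RCn Cn S_O Shat_O a ∩ RCn Cn S_O Shat_O a').Nonempty) →
      ∃ shat : 𝕊, ∀ a ∈ w, shat ∈ RCn Cn S_O Shat_O a) :
    (massOn p (atomCore Cn S_O L) = 0 → RsemZero Cn S_O Shat_O p = 0) ∧
    (0 < massOn p (atomCore Cn S_O L) →
      RsemZero Cn S_O Shat_O p =
        ((massOn p (atomCore Cn S_O L) : ℝ) : EReal) *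
          graphEntropy Cn S_O Shat_O (atomCore Cn S_O L)
            (condOn p (atomCore Cn S_O L))) := by
  have hAS : atomCore Cn S_O L ⊆ S_O := atomCore_subset S_O L
  have hCnA : Cn (atomCore Cn S_O L) = Cn S_O := Cn_atomCore hrefl hmono hidem S_O L
  generalize atomCore Cn S_O L = A at *
  obtain ⟨hp0, hp1, -⟩ := hp
  obtain ⟨a₀, ha₀⟩ := hAne
  refine ⟨fun hzero => ?_, fun hA => ?_⟩
  · obtain ⟨t, htS, htC⟩ : (Shat_O ∩ Cn S_O).Nonempty := by
      rcases hcover with h | h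
      · exact h.2
      · exact absurd hzero h.1.ne'
    have hδ : ∑ y, (Pi.single t 1 : 𝕊 → ℝ) y = 1 := by simp
    refine le_antisymm (sInf_le ⟨fun _ => Pi.single t 1, ⟨fun _ y => ?_, fun _ => hδ,
      fun _ y hy => ?_⟩, fun s hs y hy => ?_, ?_⟩) (le_sInf ?_)
    · exact (Pi.single_nonneg (α := fun _ : 𝕊 => ℝ)).2 zero_le_one y
    · obtain rfl : y = t := by
        by_contra h
        exact hy (Pi.single_eq_of_ne h 1)
      exact htS
    · obtain rfl : y = t := by
        by_contra h
        exact hy.ne' (Pi.single_eq_of_ne h 1)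
      refine Cn_replace_of_redundant hrefl hmono hidem hAS hCnA (fun hsA => hs.ne' ?_) htC
      have h0 := (Finset.sum_eq_zero_iff_of_nonneg
        (fun x _ => by split_ifs <;> simp [hp0 x])).1 hzero s (Finset.mem_univ s)
      simpa [hsA] using h0
    · rw [mutualInfo_const hp1 hδ, EReal.coe_zero]
    · rintro r ⟨W, hW, -, rfl⟩
      exact EReal.coe_nonneg.2 (mutualInfo_nonneg hp0 hp1 hW.1 hW.2.1)
  · have hcov : ∀ a ∈ A, (RCn Cn S_O Shat_O a).Nonempty := by
      rcases hcover with h | h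
      · exact absurd h.1 hA.ne'
      · exact h.2
    refine le_antisymm ?_ (le_sInf ?_)
    · have hf : ∀ w : Finset 𝕊, ∃ t ∈ Shat_O, IsIndepSet Cn S_O Shat_O A w →
          ∀ a ∈ w, t ∈ RCn Cn S_O Shat_O a := by
        intro w
        by_cases hw : w.Nonempty ∧ IsIndepSet Cn S_O Shat_O A w
        · obtain ⟨⟨a, ha⟩, hI⟩ := hw
          obtain ⟨t, ht⟩ := hpairwise w hI.1 ⟨a, ha⟩ hI.2
          exact ⟨t, (ht a ha).1, fun _ => ht⟩
        · obtain ⟨t, ht⟩ := hcov a₀ ha₀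
          exact ⟨t, ht.1, fun hI a ha => absurd ⟨⟨a, ha⟩, hI⟩ hw⟩
      choose f hfS hfR using hf
      rw [← EReal.div_le_iff_le_mul (EReal.coe_pos.2 hA) (EReal.coe_ne_top _)]
      refine le_sInf ?_
      rintro r ⟨K, hK, hKI, rfl⟩
      rw [EReal.div_le_iff_le_mul (EReal.coe_pos.2 hA) (EReal.coe_ne_top _),
        ← EReal.coe_mul]
      have hpush := hK.pushVec f hfS
      have hmem : ∀ a ∈ A, 0 < p a → ∀ t, 0 < pushVec f (K a) t →
          t ∈ RCn Cn S_O Shat_O a := by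
        intro a ha hpa t ht
        obtain ⟨w, rfl, hw⟩ := exists_pos_of_pushVec_pos ht
        obtain ⟨haw, hI⟩ := hKI a ((condOn_pos_iff hA a).2 ⟨ha, hpa⟩) w hw
        exact hfR w hI a haw
      refine le_trans (sInf_le ⟨extendChannel p A fun x => pushVec f (K x),
        hpush.extendChannel hp0 hA, fun s hs t ht => ?_, rfl⟩) ?_
      · unfold extendChannel at ht
        split_ifs at ht with hsA
        · exact (hmem s hsA hs t ht).2
        · obtain ⟨a, -, ha⟩ := Finset.exists_lt_of_sum_lt (f := fun _ : 𝕊 => (0 : ℝ))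
            (g := fun x => condOn p A x * pushVec f (K x) t) (s := Finset.univ)
            (by simpa [outMarginal] using ht)
          have hc : 0 < condOn p A a := pos_of_mul_pos_left ha (hpush.1 a t)
          obtain ⟨haA, hpa⟩ := (condOn_pos_iff hA a).1 hc
          exact Cn_replace_of_redundant hrefl hmono hidem hAS hCnA hsA
            (RCn_subset_Cn hrefl (hmem a haA hpa t (pos_of_mul_pos_right ha hc.le)))
      · rw [mutualInfo_extendChannel hp1 hpush.2.1 hA, EReal.coe_le_coe_iff]
        exact mul_le_mul_of_nonneg_left (mutualInfo_pushVec_le (condOn_nonneg hp0) hK f) hA.le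
    · rintro r ⟨W, hW, hWZ, rfl⟩
      have hg : ∀ t : 𝕊, ∃ w ∈ {w : Finset 𝕊 | w.Nonempty ∧ ↑w ⊆ A},
          ∀ a ∈ A, t ∈ RCn Cn S_O Shat_O a → a ∈ w ∧ IsIndepSet Cn S_O Shat_O A w := by
        intro t
        by_cases ht : ∃ a ∈ A, t ∈ RCn Cn S_O Shat_O a
        · obtain ⟨a, ha, hta⟩ := ht
          have hw : ∀ b, b ∈ Finset.univ.filter (fun b => b ∈ A ∧ t ∈ RCn Cn S_O Shat_O b) ↔
              b ∈ A ∧ t ∈ RCn Cn S_O Shat_O b := by simp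
          have hsub : ↑(Finset.univ.filter (fun b => b ∈ A ∧ t ∈ RCn Cn S_O Shat_O b)) ⊆ A :=
            fun b hb => ((hw b).1 hb).1
          exact ⟨_, ⟨⟨a, (hw a).2 ⟨ha, hta⟩⟩, hsub⟩, fun b hb htb => ⟨(hw b).2 ⟨hb, htb⟩, hsub,
            fun c hc d hd _ => ⟨t, ((hw c).1 hc).2, ((hw d).1 hd).2⟩⟩⟩
        · exact ⟨{a₀}, by simpa using ha₀, fun a ha hta => absurd ⟨a, ha, hta⟩ ht⟩
      choose g hgA hgI using hg
      have hle : graphEntropy Cn S_O Shat_O A (condOn p A) ≤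
          ((mutualInfo (condOn p A) fun x => pushVec g (W x) : ℝ) : EReal) := by
        refine sInf_le ⟨_, hW.pushVec g hgA, fun a ha w hw => ?_, rfl⟩
        obtain ⟨haA, hpa⟩ := (condOn_pos_iff hA a).1 ha
        obtain ⟨t, rfl, ht⟩ := exists_pos_of_pushVec_pos hw
        exact hgI t a haA ⟨hW.2.2 a t ht.ne', hWZ a hpa t ht⟩
      refine (mul_le_mul_of_nonneg_left hle (EReal.coe_nonneg.2 hA.le)).trans ?_
      rw [← EReal.coe_mul, EReal.coe_le_coe_iff]
      exact (mul_le_mul_of_nonneg_left (mutualInfo_pushVec_le (condOn_nonneg hp0) hW g)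
        hA.le).trans (massOn_mul_mutualInfo_condOn_le hp0 hp1 hW.1 hW.2.1 hA)

end
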